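/- Let (X, Y, π₁) and (Y, Z, π₂) be irreducible factor triples and π = π₂ ∘ π₁. Then the class degrees satisfy c_π ≤ c_{π₁} · c_{π₂}. -/

import Mathlib

open Set

universe u v uc

variable {A : Type u} {B : Type v}

/-- The shift by `n` on points of the full shift `ℤ → A`. -/
def shiftMap (n : ℤ) (x : ℤ → A) : ℤ → A := fun i => x (i + n)

/-- A subshift: a closed, shift-invariant subset of the full shift. -/
def IsSubshift [TopologicalSpace A] (X : Set (ℤ → A)) : Prop :=
  IsClosed X ∧ ∀ n : ℤ, ∀ x ∈ X, shiftMap n x ∈ X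

/-- The block `u` (of length `p`) occurs in `X`. -/
def OccursIn {p : ℕ} (u : Fin p → A) (X : Set (ℤ → A)) : Prop :=
  ∃ x ∈ X, ∃ i : ℤ, ∀ j : Fin p, x (i + (j.1 : ℤ)) = u j

/-- A shift of finite type: a subshift determined by a set of allowed `k`-blocks. -/
def IsSFT [TopologicalSpace A] (X : Set (ℤ → A)) : Prop :=
  IsSubshift X ∧ ∃ (k : ℕ) (P : (Fin k → A) → Prop),
    X = {x | ∀ i : ℤ, P fun j => x (i + (j.1 : ℤ))}

/-- A one-step shift of finite type: determined by allowed 2-blocks. -/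
def IsOneStep [TopologicalSpace A] (X : Set (ℤ → A)) : Prop :=
  IsSubshift X ∧ ∃ T : A → A → Prop, X = {x | ∀ i : ℤ, T (x i) (x (i + 1))}

/-- Irreducibility: any two blocks of `X` can be seen in a single point of `X`,
the second occurring after the first. -/
def IrreducibleSubshift [TopologicalSpace A] (X : Set (ℤ → A)) : Prop :=
  ∀ (p q : ℕ) (u : Fin p → A) (w : Fin q → A),
    OccursIn u X → OccursIn w X →
      ∃ x ∈ X, ∃ i k : ℤ, i + (p : ℤ) ≤ k ∧
        (∀ j : Fin p, x (i + (j.1 : ℤ)) = u j) ∧ ∀ j : Fin q, x (k + (j.1 : ℤ)) = w j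

/-- A sliding block code: given by a local rule on a finite window. -/
def IsSlidingBlockCode (π : (ℤ → A) → ℤ → B) : Prop :=
  ∃ (r : ℕ) (Φ : (Fin (2 * r + 1) → A) → B),
    ∀ x i, π x i = Φ fun j => x (i - (r : ℤ) + (j.1 : ℤ))

/-- A one-block code. -/
def IsOneBlock (π : (ℤ → A) → ℤ → B) : Prop :=
  ∃ Φ : A → B, ∀ x i, π x i = Φ (x i)

/-- `Φ` is a one-block local rule for `π`. -/
def OneBlockRule (π : (ℤ → A) → ℤ → B) (Φ : A → B) : Prop :=
  ∀ x i, π x i = Φ (x i)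

/-- A factor code from `X` onto `Y`. -/
def IsFactorCode (X : Set (ℤ → A)) (Y : Set (ℤ → B)) (π : (ℤ → A) → ℤ → B) : Prop :=
  IsSlidingBlockCode π ∧ (∀ x ∈ X, π x ∈ Y) ∧ ∀ y ∈ Y, ∃ x ∈ X, π x = y

/-- A factor triple: a factor code from an SFT `X` onto the subshift `Y`. -/
def FactorTriple [TopologicalSpace A] [TopologicalSpace B]
    (X : Set (ℤ → A)) (Y : Set (ℤ → B)) (π : (ℤ → A) → ℤ → B) : Prop :=
  IsSFT X ∧ IsSubshift Y ∧ IsFactorCode X Y π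

/-- Transition `x → x'`: for each `n` there is `z` in the fiber agreeing with `x`
on `(-∞, n]` and with `x'` on `[i, ∞)` for some `i ≥ n`. -/
def TransitionTo (X : Set (ℤ → A)) (π : (ℤ → A) → ℤ → B) (x x' : ℤ → A) : Prop :=
  ∀ n : ℤ, ∃ z ∈ X, π z = π x ∧ (∀ m ≤ n, z m = x m) ∧
    ∃ i : ℤ, n ≤ i ∧ ∀ m : ℤ, i ≤ m → z m = x' m

/-- `x ~ x'`: transitions in both directions. -/
def TransEquiv (X : Set (ℤ → A)) (π : (ℤ → A) → ℤ → B) (x x' : ℤ → A) : Prop :=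
  TransitionTo X π x x' ∧ TransitionTo X π x' x

/-- The transition class of `x` (within the fiber of `π x`). -/
def transClass (X : Set (ℤ → A)) (π : (ℤ → A) → ℤ → B) (x : ℤ → A) : Set (ℤ → A) :=
  {x' | x' ∈ X ∧ π x' = π x ∧ TransEquiv X π x x'}

/-- The set of transition classes over `y`. -/
def transClassesOver (X : Set (ℤ → A)) (π : (ℤ → A) → ℤ → B) (y : ℤ → B) :
    Set (Set (ℤ → A)) :=
  {C | ∃ x, x ∈ X ∧ π x = y ∧ C = transClass X π x}

/-- Right transitive point: its forward orbit is dense in `X`. -/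
def RightTransitive (X : Set (ℤ → A)) (x : ℤ → A) : Prop :=
  x ∈ X ∧ ∀ z ∈ X, ∀ N : ℕ, ∃ n : ℤ, 0 ≤ n ∧ ∀ m : ℤ, |m| ≤ (N : ℤ) → x (m + n) = z m

/-- Left transitive point: its backward orbit is dense in `X`. -/
def LeftTransitive (X : Set (ℤ → A)) (x : ℤ → A) : Prop :=
  x ∈ X ∧ ∀ z ∈ X, ∀ N : ℕ, ∃ n : ℤ, n ≤ 0 ∧ ∀ m : ℤ, |m| ≤ (N : ℤ) → x (m + n) = z m

/-- Doubly transitive point. -/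
def DoublyTransitive (X : Set (ℤ → A)) (x : ℤ → A) : Prop :=
  RightTransitive X x ∧ LeftTransitive X x

def MutuallySeparated (x x' : ℤ → A) : Prop := ∀ i : ℤ, x i ≠ x' i

def RightAsymptotic (x x' : ℤ → A) : Prop := ∃ N : ℤ, ∀ m : ℤ, N ≤ m → x m = x' m

def LeftAsymptotic (x x' : ℤ → A) : Prop := ∃ N : ℤ, ∀ m : ℤ, m ≤ N → x m = x' m

/-- The class degree: the minimal number of transition classes over points of `Y`. -/
noncomputable def classDegree (X : Set (ℤ → A)) (Y : Set (ℤ → B))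
    (π : (ℤ → A) → ℤ → B) : ℕ :=
  sInf {d | ∃ y ∈ Y, Nat.card (transClassesOver X π y) = d}

/-- The preimage blocks of a `Y`-block `w` under the one-block rule `Φ`. -/
def blockPre (X : Set (ℤ → A)) (Φ : A → B) {p : ℕ} (w : Fin p → B) : Set (Fin p → A) :=
  {u | OccursIn u X ∧ ∀ j, Φ (u j) = w j}

/-- `u ∈ π⁻¹(w)` is routable through `a` at time `n`. -/
def Routable (X : Set (ℤ → A)) (Φ : A → B) {p : ℕ} (w : Fin (p + 1) → B)
    (u : Fin (p + 1) → A) (n : Fin (p + 1)) (a : A) : Prop :=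
  ∃ u' ∈ blockPre X Φ w, u' 0 = u 0 ∧ u' (Fin.last p) = u (Fin.last p) ∧ u' n = a

/-- `(w, n, M)` is a transition block. -/
def IsTransBlock (X : Set (ℤ → A)) (Y : Set (ℤ → B)) (Φ : A → B) {p : ℕ}
    (w : Fin (p + 1) → B) (n : Fin (p + 1)) (M : Set A) : Prop :=
  OccursIn w Y ∧ 0 < n.1 ∧ n.1 < p ∧ (∀ a ∈ M, Φ a = w n) ∧
    ∀ u ∈ blockPre X Φ w, ∃ a ∈ M, Routable X Φ w u n a

/-- `c*_π`: the minimal depth of a transition block. -/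
noncomputable def minDepth (X : Set (ℤ → A)) (Y : Set (ℤ → B)) (Φ : A → B) : ℕ :=
  sInf {d | ∃ (p : ℕ) (w : Fin (p + 1) → B) (n : Fin (p + 1)) (M : Set A),
    IsTransBlock X Y Φ w n M ∧ Nat.card M = d}

/-- A minimal transition block. -/
def IsMinTransBlock (X : Set (ℤ → A)) (Y : Set (ℤ → B)) (Φ : A → B) {p : ℕ}
    (w : Fin (p + 1) → B) (n : Fin (p + 1)) (M : Set A) : Prop :=
  IsTransBlock X Y Φ w n M ∧ Nat.card M = minDepth X Y Φ

/-- `d(w)`: the minimal number of symbols seen at a single coordinate among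
the preimages of `w`. -/
noncomputable def dval (X : Set (ℤ → A)) (Φ : A → B) {p : ℕ} (w : Fin p → B) : ℕ :=
  sInf {m | ∃ k : Fin p, Nat.card {a : A | ∃ u ∈ blockPre X Φ w, u k = a} = m}

/-- A magic block: a block of `Y` minimizing `d(·)`. -/
def IsMagicBlock (X : Set (ℤ → A)) (Y : Set (ℤ → B)) (Φ : A → B) {p : ℕ}
    (w : Fin (p + 1) → B) : Prop :=
  OccursIn w Y ∧
    dval X Φ w = sInf {m | ∃ (q : ℕ) (v : Fin (q + 1) → B), OccursIn v Y ∧ dval X Φ v = m}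

/-- An `(X̄, v̄)`-diamond: blocks `u, v` of `X` with the same image, same
endpoints, `u` occurring in `X̄` and `v̄` a subblock of `v`. -/
def IsDiamond (X Xbar : Set (ℤ → A)) (Φ : A → B) {q p : ℕ} (vbar : Fin q → A)
    (u v : Fin (p + 1) → A) : Prop :=
  OccursIn u Xbar ∧ OccursIn v X ∧ (∀ j, Φ (u j) = Φ (v j)) ∧
    (∃ (s : ℕ) (_ : s + q ≤ p + 1), ∀ j : Fin q,
      v ⟨s + j.1, by have := j.2; omega⟩ = vbar j) ∧
    u 0 = v 0 ∧ u (Fin.last p) = v (Fin.last p)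

/-- Reversed transition `x →_r x'`. -/
def RevTransitionTo (X : Set (ℤ → A)) (π : (ℤ → A) → ℤ → B) (x x' : ℤ → A) : Prop :=
  ∀ n : ℤ, ∃ z ∈ X, π z = π x ∧ (∀ m : ℤ, n ≤ m → z m = x' m) ∧
    ∃ i : ℤ, i ≤ n ∧ ∀ m ≤ i, z m = x m

def RevTransEquiv (X : Set (ℤ → A)) (π : (ℤ → A) → ℤ → B) (x x' : ℤ → A) : Prop :=
  RevTransitionTo X π x x' ∧ RevTransitionTo X π x' x

/-- The reversed transition class of `x`. -/
def revClass (X : Set (ℤ → A)) (π : (ℤ → A) → ℤ → B) (x : ℤ → A) : Set (ℤ → A) :=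
  {x' | x' ∈ X ∧ π x' = π x ∧ RevTransEquiv X π x x'}

open scoped Classical in
/-- The standard metric on the full shift. -/
noncomputable def shiftDist (x x' : ℤ → A) : ℝ :=
  if x = x' then 0
  else
    let k : ℕ := sInf {k : ℕ | x (k : ℤ) ≠ x' (k : ℤ) ∨ x (-(k : ℤ)) ≠ x' (-(k : ℤ))}
    (2 : ℝ) ^ (-(k : ℤ))

section Words

variable {S D : Type*}

/-- `PR T L w s t`: there is a `T`-path from `s` to `t` whose labels
(excluding that of `t`) spell the word `w`. -/
def PR (T : S → S → Prop) (L : S → D) : List D → S → S → Prop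
  | [] => fun s t => s = t
  | d :: w => fun s t => L s = d ∧ ∃ s', T s s' ∧ PR T L w s' t

theorem PR_append (T : S → S → Prop) (L : S → D) (u w : List D) :
    PR T L (u ++ w) = Relation.Comp (PR T L u) (PR T L w) := by
  induction u with
  | nil => funext s t; simp [PR, Relation.Comp]
  | cons d u ih =>
    funext s t
    simp only [List.cons_append, PR, ih, Relation.Comp, eq_iff_iff]
    constructor
    · rintro ⟨h, s', hs, m, h1, h2⟩; exact ⟨m, ⟨h, s', hs, h1⟩, h2⟩
    · rintro ⟨m, ⟨h, s', hs, h1⟩, h2⟩; exact ⟨h, s', hs, m, h1, h2⟩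

theorem PR_app {T : S → S → Prop} {L : S → D} {u w : List D} {a b c : S}
    (h : PR T L u a b) (h' : PR T L w b c) : PR T L (u ++ w) a c := by
  rw [PR_append]; exact ⟨b, h, h'⟩

theorem PR_split {T : S → S → Prop} {L : S → D} {u w : List D} {a c : S}
    (h : PR T L (u ++ w) a c) : ∃ b, PR T L u a b ∧ PR T L w b c := by
  rw [PR_append] at h; exact h

/-- Powers of a word. -/
def wp (u : List D) : ℕ → List D
  | 0 => []
  | n + 1 => u ++ wp u n

theorem wp_add (u : List D) (m n : ℕ) : wp u (m + n) = wp u m ++ wp u n := by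
  induction m with
  | zero => simp [wp]
  | succ m ih => rw [Nat.succ_add]; simp [wp, ih]

theorem wp_succ' (u : List D) (n : ℕ) : wp u (n + 1) = wp u n ++ u := by
  rw [wp_add]; simp [wp]

def LiveW (T : S → S → Prop) (L : S → D) (w : List D) : Prop := ∃ s t, PR T L w s t

theorem LiveW.mid {T : S → S → Prop} {L : S → D} {u w x : List D}
    (h : LiveW T L (u ++ w ++ x)) : LiveW T L w := by
  obtain ⟨s, t, h⟩ := h
  obtain ⟨b, h1, _⟩ := PR_split h
  obtain ⟨c, _, h2⟩ := PR_split h1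
  exact ⟨_, _, h2⟩

theorem exists_pow_eq [Finite S] (T : S → S → Prop) (L : S → D) (u : List D) :
    ∃ i p, 1 ≤ p ∧ PR T L (wp u (i + p)) = PR T L (wp u i) := by
  obtain ⟨i, j, hne, h⟩ := Finite.exists_ne_map_eq_of_infinite (fun n : ℕ => PR T L (wp u n))
  rcases lt_or_gt_of_ne hne with hl | hl
  · exact ⟨i, j - i, by omega, by rw [Nat.add_sub_of_le hl.le]; exact h.symm⟩
  · exact ⟨j, i - j, by omega, by rw [Nat.add_sub_of_le hl.le]; exact h⟩

theorem idem_pow [Finite S] (T : S → S → Prop) (L : S → D) (u : List D) :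
    ∃ k, 1 ≤ k ∧ PR T L (wp u k ++ wp u k) = PR T L (wp u k) := by
  obtain ⟨i, p, hp, h⟩ := exists_pow_eq T L u
  have h1 : ∀ n, i ≤ n → PR T L (wp u (n + p)) = PR T L (wp u n) := by
    intro n hn
    obtain ⟨m, rfl⟩ := Nat.exists_eq_add_of_le hn
    rw [show i + m + p = (i + p) + m by ring, wp_add, PR_append, h, ← PR_append, ← wp_add]
  have h2 : ∀ q n, i ≤ n → PR T L (wp u (n + q * p)) = PR T L (wp u n) := by
    intro q
    induction q with
    | zero => intro n _; simp
    | succ q ih =>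
      intro n hn
      rw [show n + (q + 1) * p = (n + q * p) + p by ring, h1 _ (by omega), ih n hn]
  refine ⟨(i + 1) * p, by nlinarith, ?_⟩
  rw [← wp_add]
  exact h2 _ _ (by nlinarith)

/-- `w` generates a minimal right ideal (in a weak sense). -/
def StarW (T : S → S → Prop) (L : S → D) (w : List D) : Prop :=
  PR T L (w ++ w) = PR T L w ∧
  ∀ v, LiveW T L (w ++ v ++ w) → ∃ v', PR T L (w ++ v ++ w ++ v') = PR T L w

theorem live_wp {T : S → S → Prop} {L : S → D} {u : List D} {a : S}
    (h : PR T L u a a) (n : ℕ) : PR T L (wp u n) a a := by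
  induction n with
  | zero => rfl
  | succ n ih => exact PR_app h ih

theorem exists_star [Finite S] (T : S → S → Prop) (L : S → D) (w0 : List D)
    (hl : LiveW T L w0)
    (hconn : ∀ w a b, w0 <:+: w → PR T L w a b → ∃ v, PR T L v b a) :
    ∃ w, w0 <:+: w ∧ LiveW T L w ∧ StarW T L w := by
  let I : List D → Set (S → S → Prop) := fun w =>
    {r | ∃ v, r = PR T L (w ++ v) ∧ LiveW T L (w ++ v)}
  have hI : ∀ w x, I (w ++ x) ⊆ I w := by
    rintro w x r ⟨v, hr, hlv⟩
    exact ⟨x ++ v, by rw [hr, List.append_assoc], by rwa [List.append_assoc] at hlv⟩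
  obtain ⟨w1, ⟨hw01, hl1⟩, hmin⟩ : ∃ w1, (w0 <:+: w1 ∧ LiveW T L w1) ∧
      ∀ w, (w0 <:+: w ∧ LiveW T L w) → (I w1).ncard ≤ (I w).ncard := by
    have := (measure fun w : List D => (I w).ncard).wf.has_min
      {w | w0 <:+: w ∧ LiveW T L w} ⟨w0, List.infix_refl _, hl⟩
    obtain ⟨m, hm, h⟩ := this
    exact ⟨m, hm, fun w hw => not_lt.mp (h w hw)⟩
  obtain ⟨a, b, hab⟩ := hl1
  obtain ⟨v, hv⟩ := hconn w1 a b hw01 hab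
  have hloop : PR T L (w1 ++ v) a a := PR_app hab hv
  obtain ⟨k, hk, hid⟩ := idem_pow T L (w1 ++ v)
  obtain ⟨k, rfl⟩ := Nat.exists_eq_add_of_le' hk
  set w := wp (w1 ++ v) (k + 1) with hw
  have hw' : w = w1 ++ (v ++ wp (w1 ++ v) k) := by simp [hw, wp]
  have hinf : w0 <:+: w := by
    rw [hw']; exact hw01.trans (List.prefix_append _ _).isInfix
  have hlive : LiveW T L w := ⟨a, a, live_wp hloop _⟩
  refine ⟨w, hinf, hlive, hid, ?_⟩
  intro x hx
  have hsub : I (w ++ x ++ w) ⊆ I w := by rw [List.append_assoc]; exact hI _ _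
  have hcard : (I w).ncard ≤ (I (w ++ x ++ w)).ncard := by
    refine le_trans ?_ (hmin (w ++ x ++ w) ⟨?_, hx⟩)
    · rw [hw']; exact Set.ncard_le_ncard (hI _ _) (Set.toFinite _)
    · rw [List.append_assoc]; exact hinf.trans (List.prefix_append _ _).isInfix
  have heq := Set.eq_of_subset_of_ncard_le hsub hcard (Set.toFinite _)
  have : PR T L w ∈ I w := ⟨[], by simp, by simpa using hlive⟩
  rw [← heq] at this
  obtain ⟨v', h1, _⟩ := this
  exact ⟨v', h1.symm⟩

theorem StarW.unit [Finite S] {T : S → S → Prop} {L : S → D} {w : List D}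
    (hs : StarW T L w) (v : List D) (hv : LiveW T L (w ++ v ++ w)) :
    ∃ k, PR T L (wp (w ++ v ++ w) (k + 1)) = PR T L w := by
  obtain ⟨hid, hst⟩ := hs
  obtain ⟨v', hv'⟩ := hst v hv
  set W := w ++ v ++ w with hW
  have hWw : PR T L (W ++ w) = PR T L W := by
    rw [hW, List.append_assoc (w ++ v), PR_append, hid, ← PR_append]
  have h1 : ∀ n, PR T L (wp W n ++ (w ++ wp v' n)) = PR T L w := by
    intro n
    induction n with
    | zero => simp [wp]
    | succ n ih =>
      rw [wp_succ', wp, show wp W n ++ W ++ (w ++ (v' ++ wp v' n)) =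
        wp W n ++ ((W ++ w) ++ (v' ++ wp v' n)) by simp, PR_append, PR_append _ _ (W ++ w), hWw,
        ← PR_append, ← List.append_assoc, PR_append _ _ (W ++ v'), hv', ← PR_append, ← PR_append]
      exact ih
  obtain ⟨i, p, hp, h⟩ := exists_pow_eq T L W
  obtain ⟨p, rfl⟩ := Nat.exists_eq_add_of_le' hp
  refine ⟨p, ?_⟩
  have h2 : PR T L (wp W (i + (p + 1)) ++ (w ++ wp v' i)) = PR T L w := by
    rw [PR_append, h, ← PR_append, h1]
  rw [add_comm i, wp_add, List.append_assoc, PR_append, h1, ← PR_append, wp_succ',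
    List.append_assoc, PR_append, hWw, ← PR_append] at h2
  rw [wp_succ', h2]

theorem exists_recurrent [Finite S] {E : S → S → Prop} (hE : Relation.Comp E E = E) {a b : S}
    (hab : E a b) : ∃ c, E a c ∧ E c c ∧ E c b := by
  by_contra hcon
  push Not at hcon
  have htr : ∀ {x y z}, E x y → E y z → E x z := fun {x y z} h1 h2 => by
    rw [← hE]; exact ⟨y, h1, h2⟩
  have hden : ∀ {x y}, E x y → ∃ z, E x z ∧ E z y := fun {x y} h => by
    rw [← hE] at h; exact h
  let Q := {x // E a x ∧ E x b}
  let r : Q → Q → Prop := fun x y => E x.1 y.1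
  have : IsTrans Q r := ⟨fun _ _ _ => htr⟩
  have : Std.Irrefl r := ⟨fun x hx => hcon x.1 x.2.1 hx x.2.2⟩
  have wf : WellFounded r := Finite.wellFounded_of_trans_of_irrefl r
  obtain ⟨z, hz⟩ := hden hab
  obtain ⟨m, _, hm⟩ := wf.has_min Set.univ ⟨⟨z, hz⟩, trivial⟩
  obtain ⟨y, hy1, hy2⟩ := hden m.2.1
  exact hm ⟨y, hy1, htr hy2 m.2.2⟩ trivial hy2

theorem StarW.symm [Finite S] {T : S → S → Prop} {L : S → D} {w : List D}
    (hs : StarW T L w) {a c : S} (haa : PR T L w a a) (hcc : PR T L w c c) (hac : PR T L w a c)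
    {v : List D} (hv : PR T L v c a) : PR T L w c a := by
  have hF : PR T L (w ++ v ++ w) c a := PR_app (PR_app hcc hv) haa
  obtain ⟨k, hk⟩ := hs.unit v ⟨_, _, hF⟩
  have hFc : PR T L (w ++ v ++ w) c c := PR_app (PR_app hcc hv) hac
  rw [← hk, wp_succ']
  exact PR_app (live_wp hFc k) hF

/-- The word `w` routes through at most `n` states. -/
def ThrW (T : S → S → Prop) (L : S → D) (w : List D) (n : ℕ) : Prop :=
  ∃ (w' w'' : List D) (m : Fin n → S), w = w' ++ w'' ∧
    ∀ s t, PR T L w s t → ∃ i, PR T L w' s (m i) ∧ PR T L w'' (m i) t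

theorem ThrW.ext {T : S → S → Prop} {L : S → D} {w0 w : List D} {n : ℕ}
    (h : ThrW T L w0 n) (hw : w0 <:+: w) : ThrW T L w n := by
  obtain ⟨w', w'', m, rfl, hm⟩ := h
  obtain ⟨p, q, rfl⟩ := hw
  refine ⟨p ++ w', w'' ++ q, m, by simp, ?_⟩
  intro s t hst
  obtain ⟨b, h1, h2⟩ := PR_split hst
  obtain ⟨c, h3, h4⟩ := PR_split h1
  obtain ⟨i, h5, h6⟩ := hm c b h4
  exact ⟨i, PR_app h3 h5, PR_app h6 h2⟩

end Words

section Comb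

variable {S D D' : Type*}

theorem PR_ess {T : S → S → Prop} {L : S → D} {Ess : S → Prop}
    (hess : ∀ s t, T s t → Ess s ∧ Ess t) {w : List D} (hw : w ≠ []) {s t : S}
    (h : PR T L w s t) : Ess s ∧ Ess t := by
  induction w generalizing s with
  | nil => exact absurd rfl hw
  | cons d w ih =>
    obtain ⟨_, s', h1, h2⟩ := h
    refine ⟨(hess _ _ h1).1, ?_⟩
    by_cases hw' : w = []
    · subst hw'; cases h2; exact (hess _ _ h1).2
    · exact (ih hw' h2).2

theorem PR_map {T : S → S → Prop} {L : S → D} (f : D → D') {w : List D} {s t : S}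
    (h : PR T L w s t) : PR T (fun x => f (L x)) (w.map f) s t := by
  induction w generalizing s with
  | nil => exact h
  | cons d w ih =>
    obtain ⟨h0, s', h1, h2⟩ := h
    exact ⟨congrArg f h0, s', h1, ih h2⟩

theorem PR_lift {T : S → S → Prop} {L : S → D} {f : D → D'} {w : List D'} {s t : S}
    (h : PR T (fun x => f (L x)) w s t) : ∃ b : List D, b.map f = w ∧ PR T L b s t := by
  induction w generalizing s with
  | nil => exact ⟨[], rfl, h⟩
  | cons d w ih =>
    obtain ⟨h0, s', h1, h2⟩ := h
    obtain ⟨b, hb, hb'⟩ := ih h2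
    exact ⟨L s :: b, by simp [h0, hb], rfl, s', h1, hb'⟩

theorem PR_push {T : S → S → Prop} {T2 : D → D → Prop} {lam : S → D}
    (hT : ∀ s t, T s t → T2 (lam s) (lam t)) {w : List D} {s t : S}
    (h : PR T lam w s t) : PR T2 (fun x => x) w (lam s) (lam t) := by
  induction w generalizing s with
  | nil => cases h; rfl
  | cons d w ih =>
    obtain ⟨h0, s', h1, h2⟩ := h
    exact ⟨h0, lam s', hT _ _ h1, ih h2⟩

theorem wp_map (f : D → D') (u : List D) (n : ℕ) : (wp u n).map f = wp (u.map f) n := by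
  induction n with
  | zero => rfl
  | succ n ih => simp [wp, ih]

theorem exists_big [Finite S] {T : S → S → Prop} {lam : S → D} {ell : D → D'}
    {Ess : S → Prop} (hess : ∀ s t, T s t → Ess s ∧ Ess t)
    (hconn : ∀ s t, Ess s → Ess t → ∃ w, PR T (fun x => ell (lam x)) w s t)
    {w : List D'} (hw : w ≠ []) (hs : StarW T (fun x => ell (lam x)) w)
    {w1 : List D} (hw1 : w1 ≠ []) (hl1 : LiveW T lam w1)
    {w2 : List D'} (hw2 : w2 ≠ []) (hl2 : LiveW T (fun x => ell (lam x)) w2) (l : List S) :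
    ∃ V, PR T (fun x => ell (lam x)) V = PR T (fun x => ell (lam x)) w ∧
      ∀ a ∈ l, PR T (fun x => ell (lam x)) w a a → w2 <:+: V ∧
        ∃ b, PR T lam b a a ∧ b.map ell = V ∧ w1 <:+: b := by
  have hid : Relation.Comp (PR T (fun x => ell (lam x)) w) (PR T (fun x => ell (lam x)) w) =
      PR T (fun x => ell (lam x)) w := by rw [← PR_append]; exact hs.1
  induction l with
  | nil => exact ⟨w, rfl, by simp⟩
  | cons a l ih =>
    obtain ⟨V, hV, hVl⟩ := ih
    by_cases ha : PR T (fun x => ell (lam x)) w a a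
    swap
    · refine ⟨V, hV, fun c hc hcc => ?_⟩
      rcases List.mem_cons.mp hc with rfl | hc
      · exact absurd hcc ha
      · exact hVl c hc hcc
    obtain ⟨s1, t1, h1⟩ := hl1
    obtain ⟨s2, t2, h2⟩ := hl2
    have ea := (PR_ess hess hw ha).1
    have e1 := PR_ess hess hw1 h1
    have e2 := PR_ess hess hw2 h2
    obtain ⟨u0, hu0⟩ := hconn a s1 ea e1.1
    obtain ⟨u1, hu1⟩ := hconn t1 s2 e1.2 e2.1
    obtain ⟨u3, hu3⟩ := hconn t2 a e2.2 ea
    obtain ⟨b0, -, hb0⟩ := PR_lift hu0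
    obtain ⟨b1, -, hb1⟩ := PR_lift hu1
    obtain ⟨b2, hb2w, hb2⟩ := PR_lift h2
    obtain ⟨b3, -, hb3⟩ := PR_lift hu3
    obtain ⟨bw, hbw, hbwa⟩ := PR_lift ha
    set b := b0 ++ (w1 ++ (b1 ++ (b2 ++ b3))) with hb
    have hba : PR T lam b a a := PR_app hb0 (PR_app h1 (PR_app hb1 (PR_app hb2 hb3)))
    have hW : PR T lam (bw ++ b ++ bw) a a := PR_app (PR_app hbwa hba) hbwa
    have hmap : (bw ++ b ++ bw).map ell = w ++ b.map ell ++ w := by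
      simp only [List.map_append, hbw]
    have hWl := PR_map ell hW
    rw [hmap] at hWl
    obtain ⟨k, hk⟩ := hs.unit _ ⟨_, _, hWl⟩
    have hw1b : w1 <:+: wp (bw ++ b ++ bw) (k + 1) := by
      refine ⟨bw ++ b0, b1 ++ (b2 ++ b3) ++ bw ++ wp (bw ++ b ++ bw) k, ?_⟩
      simp [wp, hb]
    have hw2b : w2 <:+: wp (w ++ b.map ell ++ w) (k + 1) := by
      refine ⟨w ++ (b0 ++ (w1 ++ b1)).map ell,
        b3.map ell ++ w ++ wp (w ++ b.map ell ++ w) k, ?_⟩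
      simp [wp, hb, hb2w]
    refine ⟨wp (w ++ b.map ell ++ w) (k + 1) ++ V, by rw [PR_append, hk, hV, hid], ?_⟩
    intro c hc hcc
    refine ⟨hw2b.trans (List.prefix_append _ _).isInfix, ?_⟩
    rcases List.mem_cons.mp hc with rfl | hc
    · have := hcc
      rw [← hV] at this
      obtain ⟨bV, hbV, hbVc⟩ := PR_lift this
      refine ⟨wp (bw ++ b ++ bw) (k + 1) ++ bV, PR_app (live_wp hW _) hbVc, ?_,
        hw1b.trans (List.prefix_append _ _).isInfix⟩
      rw [List.map_append, wp_map, hmap, hbV]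
    · obtain ⟨-, bc, hbc, hbcm, hbcw⟩ := hVl c hc hcc
      have := hcc
      rw [← hk] at this
      obtain ⟨bV, hbV, hbVc⟩ := PR_lift this
      exact ⟨bV ++ bc, PR_app hbVc hbc, by rw [List.map_append, hbV, hbcm],
        hbcw.trans (List.suffix_append _ _).isInfix⟩

/-- The combinatorial heart: the number of recurrent classes is submultiplicative. -/
theorem comb_main [Finite S] {T : S → S → Prop} {T2 : D → D → Prop} {lam : S → D} {ell : D → D'}
    (hT : ∀ s t, T s t → T2 (lam s) (lam t))
    {Ess : S → Prop} (hess : ∀ s t, T s t → Ess s ∧ Ess t)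
    (hconn : ∀ s t, Ess s → Ess t → ∃ w, PR T (fun x => ell (lam x)) w s t)
    (hlift : ∀ b p q, b ≠ [] → PR T2 (fun x => x) b p q → LiveW T lam b)
    {w : List D'} (hw : w ≠ []) (hs : StarW T (fun x => ell (lam x)) w)
    {w1 : List D} (hw1 : w1 ≠ []) (hl1 : LiveW T lam w1) (hs1 : StarW T lam w1)
    {w2 : List D'} (hw2 : w2 ≠ []) (hl2 : LiveW T (fun x => ell (lam x)) w2)
    {n1 n2 : ℕ} (ht1 : ThrW T lam w1 n1) (ht2 : ThrW T2 ell w2 n2) :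
    ∃ κ : {a // PR T (fun x => ell (lam x)) w a a} → Fin n1 × Fin n2,
      ∀ a c, κ a = κ c → PR T (fun x => ell (lam x)) w a.1 c.1 := by
  classical
  have : Fintype S := Fintype.ofFinite S
  set R := PR T (fun x => ell (lam x)) with hR
  have hid : Relation.Comp (R w) (R w) = R w := by rw [← PR_append]; exact hs.1
  obtain ⟨V, hV, hVl⟩ := exists_big hess hconn hw hs hw1 hl1 hw2 hl2 Finset.univ.toList
  have key : ∀ a : {a // R w a a}, ∃ b : List D, PR T lam b a.1 a.1 ∧ b.map ell = V ∧
      w1 <:+: b := fun a => (hVl a.1 (by simp) a.2).2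
  choose bt hbt hbtm hbti using key
  choose sl tl hst using hbti
  by_cases hne : Nonempty {a // R w a a}
  swap
  · exact ⟨fun a => absurd ⟨a⟩ hne, fun a => absurd ⟨a⟩ hne⟩
  obtain ⟨a0⟩ := hne
  obtain ⟨V1, V2, m2, hV12, hm2⟩ := ht2.ext (hVl a0.1 (by simp) a0.2).1
  have col2 : ∀ a : {a // R w a a}, ∃ i, PR T2 ell V1 (lam a.1) (m2 i) ∧
      PR T2 ell V2 (m2 i) (lam a.1) := by
    intro a
    apply hm2
    have := PR_map ell (PR_push hT (hbt a))
    rwa [hbtm a] at this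
  choose c2 hc2a hc2b using col2
  -- representatives of the colour classes
  let rep : Fin n2 → {a // R w a a} := fun i => if h : ∃ a, c2 a = i then h.choose else a0
  have hrep : ∀ a, c2 (rep (c2 a)) = c2 a := by
    intro a
    have h : ∃ a', c2 a' = c2 a := ⟨a, rfl⟩
    simp only [rep, dif_pos h]
    exact h.choose_spec
  have hγ : ∀ a, ∃ γ : List D, γ.map ell = V ∧
      PR T2 (fun x => x) γ (lam a.1) (lam (rep (c2 a)).1) := by
    intro a
    have h1 : PR T2 ell V (lam a.1) (lam (rep (c2 a)).1) := by
      rw [hV12]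
      refine PR_app (hc2a a) ?_
      have := hc2b (rep (c2 a))
      rwa [hrep a] at this
    exact PR_lift (L := fun x => x) (f := ell) h1
  choose γ hγm hγp using hγ
  obtain ⟨w', w'', m1, hw12, hm1⟩ := ht1
  have col1 : ∀ a, ∃ i, PR T lam (bt a ++ γ a ++ sl (rep (c2 a)) ++ w') a.1 (m1 i) ∧
      ∃ b d, PR T lam (w'' ++ tl (rep (c2 a))) (m1 i) b ∧
        PR T lam (bt (rep (c2 a))) b d := by
    intro a
    set r := rep (c2 a) with hr
    have hsplit := hbt a
    rw [← hst a] at hsplit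
    obtain ⟨a2, h12, h3⟩ := PR_split hsplit
    obtain ⟨a1, h1, h2⟩ := PR_split h12
    -- the long word is live
    have hbr := PR_push hT (hbt r)
    have hlong : LiveW T lam (bt a ++ γ a ++ bt r ++ bt r ++ bt r) := by
      refine hlift _ _ _ ?_ (PR_app (PR_app (PR_app (PR_app (PR_push hT (hbt a)) (hγp a)) hbr)
        hbr) hbr)
      rw [← hst a]
      simp [hw1]
    let x := tl a ++ γ a ++ sl r ++ w1 ++ tl r ++ bt r ++ sl r
    have hlive : LiveW T lam (w1 ++ x ++ w1) := by
      have e : bt a ++ γ a ++ bt r ++ bt r ++ bt r = sl a ++ (w1 ++ x ++ w1) ++ tl r := by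
        conv_lhs => rw [← hst a]
        have e2 : bt r ++ bt r ++ bt r = (sl r ++ w1 ++ tl r) ++ bt r ++ (sl r ++ w1 ++ tl r) := by
          rw [hst r]
        rw [List.append_assoc, List.append_assoc, ← List.append_assoc (bt r), e2]
        simp [x]
      rw [e] at hlong
      exact hlong.mid
    obtain ⟨v', hv'⟩ := hs1.2 x hlive
    rw [← hv', show w1 ++ x ++ w1 ++ v' = (w1 ++ tl a ++ γ a ++ sl r) ++ (w1 ++ (tl r ++ (bt r ++
      (sl r ++ w1 ++ v')))) by simp [x]] at h2
    obtain ⟨e0, g1, g2⟩ := PR_split h2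
    obtain ⟨e, g3, g4⟩ := PR_split g2
    obtain ⟨b, g5, g6⟩ := PR_split g4
    obtain ⟨d, g7, g8⟩ := PR_split g6
    obtain ⟨i, g9, g10⟩ := hm1 _ _ g3
    refine ⟨i, ?_, b, d, PR_app g10 g5, g7⟩
    have := PR_app (PR_app h1 g1) g9
    rw [← hst a]
    simpa using this
  choose c1 hc1 bb dd hbb hdd using col1
  refine ⟨fun a => (c1 a, c2 a), ?_⟩
  intro a c hac
  simp only [Prod.mk.injEq] at hac
  obtain ⟨hac1, hac2⟩ := hac
  have toE : ∀ (b : List D) s t, PR T lam b s t → b.map ell = V → R w s t := by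
    intro b s t h hb
    rw [hR, ← hV, ← hb]
    exact PR_map ell h
  have htr : ∀ {x y z}, R w x y → R w y z → R w x z := fun {x y z} h1 h2 => by
    rw [← hid]; exact ⟨y, h1, h2⟩
  have go : ∀ a', c1 a' = c1 c → c2 a' = c2 c → R w a'.1 (bb c) := by
    intro a' e1 e2
    have h1 := hc1 a'
    have h2 := hbb c
    rw [← e1, ← e2] at h2
    have h3 := PR_app h1 h2
    have h4 : PR T lam (bt a' ++ γ a' ++ bt (rep (c2 a'))) a'.1 (bb c) := by
      rw [← hst (rep (c2 a')), hw12]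
      simpa using h3
    obtain ⟨p, h5, h6⟩ := PR_split h4
    obtain ⟨q, h7, h8⟩ := PR_split h5
    exact htr (htr (toE _ _ _ h7 (hbtm _)) (toE _ _ _ h8 (hγm _))) (toE _ _ _ h6 (hbtm _))
  have hbd : R w (bb c) (dd c) := toE _ _ _ (hdd c) (hbtm _)
  obtain ⟨f, hf1, hf2, -⟩ := exists_recurrent hid hbd
  have haf := htr (go a hac1 hac2) hf1
  have hcf := htr (go c rfl rfl) hf1
  obtain ⟨v, hv⟩ := hconn f c.1 (PR_ess hess hw hf2).1 (PR_ess hess hw c.2).1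
  exact htr haf (hs.symm c.2 hf2 hcf hv)

end Comb

section Points

variable {S D : Type*}

/-- The word of length `n` seen in `z` from position `i`. -/
def wordAt (z : ℤ → D) (i : ℤ) : ℕ → List D
  | 0 => []
  | n + 1 => z i :: wordAt z (i + 1) n

theorem wordAt_add (z : ℤ → D) (i : ℤ) (m n : ℕ) :
    wordAt z i (m + n) = wordAt z i m ++ wordAt z (i + m) n := by
  induction m generalizing i with
  | zero => simp [wordAt]
  | succ m ih =>
    rw [Nat.succ_add]
    simp only [wordAt, ih, List.cons_append]
    congr 3
    push_cast; ring

theorem wordAt_length (z : ℤ → D) (i : ℤ) (n : ℕ) : (wordAt z i n).length = n := by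
  induction n generalizing i with
  | zero => rfl
  | succ n ih => simp [wordAt, ih]

theorem wordAt_getElem (z : ℤ → D) (i : ℤ) (n k : ℕ) (h : k < (wordAt z i n).length) :
    (wordAt z i n)[k] = z (i + k) := by
  induction n generalizing i k with
  | zero => simp [wordAt] at h
  | succ n ih =>
    cases k with
    | zero => simp [wordAt]
    | succ k =>
      simp only [wordAt, List.getElem_cons_succ]
      rw [ih]
      congr 1; push_cast; ring

theorem PR_of_path {T : S → S → Prop} {L : S → D} {z : ℤ → D} {x : ℤ → S} {i : ℤ} {n : ℕ}
    (h : ∀ j, i ≤ j → j < i + n → T (x j) (x (j + 1)) ∧ L (x j) = z j) :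
    PR T L (wordAt z i n) (x i) (x (i + n)) := by
  induction n generalizing i with
  | zero => simp [wordAt, PR]
  | succ n ih =>
    refine ⟨(h i le_rfl (by push_cast; omega)).2, x (i + 1),
      (h i le_rfl (by push_cast; omega)).1, ?_⟩
    have := ih (i := i + 1) fun j h1 h2 => h j (by omega) (by push_cast; omega)
    rwa [show i + 1 + (n : ℤ) = i + ((n + 1 : ℕ) : ℤ) by push_cast; ring] at this

theorem path_of_PR {T : S → S → Prop} {L : S → D} {z : ℤ → D} {i : ℤ} {n : ℕ} {s t : S}
    (h : PR T L (wordAt z i n) s t) : ∃ p : ℤ → S, p i = s ∧ p (i + n) = t ∧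
      ∀ j, i ≤ j → j < i + n → T (p j) (p (j + 1)) ∧ L (p j) = z j := by
  induction n generalizing i s with
  | zero =>
    refine ⟨fun _ => s, rfl, h, fun j h1 h2 => ?_⟩
    simp at h2; omega
  | succ n ih =>
    obtain ⟨h0, s', h1, h2⟩ := h
    obtain ⟨p, hp1, hp2, hp3⟩ := ih h2
    refine ⟨fun j => if j ≤ i then s else p j, by simp, ?_, ?_⟩
    · beta_reduce
      rw [if_neg (by push_cast; omega), ← hp2]
      congr 1; push_cast; ring
    · intro j hj1 hj2
      rcases hj1.eq_or_lt with rfl | hlt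
      · simp only [le_refl, if_true]
        rw [if_neg (by omega), hp1]
        exact ⟨h1, h0⟩
      · beta_reduce
        rw [if_neg (by omega), if_neg (by omega)]
        exact hp3 j (by omega) (by push_cast at hj2; omega)

/-- Bi-infinite paths of a graph. -/
def pathSet (T : S → S → Prop) : Set (ℤ → S) := {x | ∀ i : ℤ, T (x i) (x (i + 1))}

/-- The one-block code of a labelling. -/
def obc (L : S → D) : (ℤ → S) → ℤ → D := fun x i => L (x i)

/-- Points over `z`. -/
def FibP (T : S → S → Prop) (L : S → D) (z : ℤ → D) (x : ℤ → S) : Prop :=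
  x ∈ pathSet T ∧ obc L x = z

theorem FibP.pr {T : S → S → Prop} {L : S → D} {z : ℤ → D} {x : ℤ → S} (h : FibP T L z x)
    (i : ℤ) (n : ℕ) : PR T L (wordAt z i n) (x i) (x (i + n)) :=
  PR_of_path fun j _ _ => ⟨h.1 j, congrFun h.2 j⟩

theorem splice {T : S → S → Prop} {L : S → D} {z : ℤ → D} {x x' : ℤ → S}
    (hx : FibP T L z x) (hx' : FibP T L z x') {n : ℤ} {k : ℕ}
    (h : PR T L (wordAt z n k) (x n) (x' (n + k))) :
    ∃ y, FibP T L z y ∧ (∀ m ≤ n, y m = x m) ∧ ∀ m, n + k ≤ m → y m = x' m := by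
  obtain ⟨p, hp1, hp2, hp3⟩ := path_of_PR h
  let y : ℤ → S := fun m => if m < n then x m else if m < n + k then p m else x' m
  have y1 : ∀ m ≤ n, y m = x m := by
    intro m hm
    rcases hm.lt_or_eq with hm | rfl
    · simp [y, hm]
    · by_cases hk : m < m + (k : ℤ)
      · simp only [y, lt_irrefl, if_false, if_pos hk, hp1]
      · simp only [y, lt_irrefl, if_false, if_neg hk]
        have : m + (k : ℤ) = m := by omega
        rw [this] at hp2
        rw [← hp2, hp1]
  have y2 : ∀ m, n ≤ m → m ≤ n + k → y m = p m := by
    intro m hm hm'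
    rcases hm'.lt_or_eq with hm' | rfl
    · simp [y, hm', not_lt.mpr hm]
    · simp only [y, if_neg (not_lt.mpr hm), lt_irrefl, if_false, hp2]
  have y3 : ∀ m, n + k ≤ m → y m = x' m := by
    intro m hm
    simp only [y, if_neg (not_lt.mpr hm), if_neg (show ¬ m < n by omega)]
  refine ⟨y, ⟨?_, ?_⟩, y1, y3⟩
  · intro m
    rcases lt_or_ge m n with h1 | h1
    · rw [y1 m h1.le, y1 (m + 1) (by omega)]; exact hx.1 m
    rcases lt_or_ge m (n + k) with h2 | h2
    · rw [y2 m h1 h2.le, y2 (m + 1) (by omega) (by omega)]; exact (hp3 m h1 h2).1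
    · rw [y3 m h2, y3 (m + 1) (by omega)]; exact hx'.1 m
  · funext m
    change L (y m) = z m
    rcases lt_or_ge m n with h1 | h1
    · rw [y1 m h1.le]; exact congrFun hx.2 m
    rcases lt_or_ge m (n + k) with h2 | h2
    · rw [y2 m h1 h2.le]; exact (hp3 m h1 h2).2
    · rw [y3 m h2]; exact congrFun hx'.2 m

theorem reach_mono {T : S → S → Prop} {L : S → D} {z : ℤ → D} {x' : ℤ → S} {s : S}
    (hx' : FibP T L z x') {n : ℤ} {k l : ℕ} (hkl : k ≤ l)
    (h : PR T L (wordAt z n k) s (x' (n + k))) : PR T L (wordAt z n l) s (x' (n + l)) := by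
  obtain ⟨d, rfl⟩ := Nat.exists_eq_add_of_le hkl
  rw [wordAt_add]
  refine PR_app h ?_
  have := hx'.pr (n + k) d
  rwa [show n + (k : ℤ) + d = n + ((k + d : ℕ) : ℤ) by push_cast; ring] at this

theorem trans_iff {T : S → S → Prop} {L : S → D} {z : ℤ → D} {x x' : ℤ → S}
    (hx : FibP T L z x) (hx' : FibP T L z x') :
    TransitionTo (pathSet T) (obc L) x x' ↔
      ∀ n : ℤ, ∃ k : ℕ, PR T L (wordAt z n k) (x n) (x' (n + k)) := by
  constructor
  · intro h n
    obtain ⟨y, hy, hyx, h1, i, hi, h2⟩ := h n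
    obtain ⟨k, rfl⟩ := Int.le.dest hi
    refine ⟨k, ?_⟩
    have : FibP T L z y := ⟨hy, hyx.trans hx.2⟩
    have := this.pr n k
    rwa [h1 n le_rfl, h2 _ le_rfl] at this
  · intro h n
    obtain ⟨k, hk⟩ := h n
    obtain ⟨y, hy, h1, h2⟩ := splice hx hx' hk
    exact ⟨y, hy.1, hy.2.trans hx.2.symm, h1, n + k, by omega, h2⟩

theorem trans_of_freq {T : S → S → Prop} {L : S → D} {z : ℤ → D} {x x' : ℤ → S}
    (hx : FibP T L z x) (hx' : FibP T L z x')
    (h : ∀ n : ℤ, ∃ j, n ≤ j ∧ ∃ k : ℕ, PR T L (wordAt z j k) (x j) (x' (j + k))) :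
    TransitionTo (pathSet T) (obc L) x x' := by
  rw [trans_iff hx hx']
  intro n
  obtain ⟨j, hj, k, hk⟩ := h n
  obtain ⟨d, rfl⟩ := Int.le.dest hj
  refine ⟨d + k, ?_⟩
  rw [wordAt_add]
  refine PR_app (hx.pr n d) ?_
  rwa [show n + ((d + k : ℕ) : ℤ) = n + d + k by push_cast; ring]

theorem trans_trans {T : S → S → Prop} {L : S → D} {z : ℤ → D} {x x' x'' : ℤ → S}
    (hx : FibP T L z x) (hx' : FibP T L z x') (hx'' : FibP T L z x'')
    (h : TransitionTo (pathSet T) (obc L) x x') (h' : TransitionTo (pathSet T) (obc L) x' x'') :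
    TransitionTo (pathSet T) (obc L) x x'' := by
  rw [trans_iff hx hx'] at h
  rw [trans_iff hx' hx''] at h'
  rw [trans_iff hx hx'']
  intro n
  obtain ⟨k, hk⟩ := h n
  obtain ⟨l, hl⟩ := h' (n + k)
  refine ⟨k + l, ?_⟩
  rw [wordAt_add]
  refine PR_app hk ?_
  rwa [show n + ((k + l : ℕ) : ℤ) = n + k + l by push_cast; ring]

theorem transClass_eq {T : S → S → Prop} {L : S → D} {z : ℤ → D} {x x' : ℤ → S}
    (hx : FibP T L z x) (hx' : FibP T L z x')
    (h : TransEquiv (pathSet T) (obc L) x x') :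
    transClass (pathSet T) (obc L) x = transClass (pathSet T) (obc L) x' := by
  ext y
  constructor
  · rintro ⟨hy, hyx, h1, h2⟩
    have hyf : FibP T L z y := ⟨hy, hyx.trans hx.2⟩
    exact ⟨hy, hyf.2.trans hx'.2.symm, trans_trans hx' hx hyf h.2 h1, trans_trans hyf hx hx' h2 h.1⟩
  · rintro ⟨hy, hyx, h1, h2⟩
    have hyf : FibP T L z y := ⟨hy, hyx.trans hx'.2⟩
    exact ⟨hy, hyf.2.trans hx.2.symm, trans_trans hx hx' hyf h.1 h1, trans_trans hyf hx' hx h2 h.2⟩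

theorem trans_refl {T : S → S → Prop} {L : S → D} {z : ℤ → D} {x : ℤ → S}
    (hx : FibP T L z x) : TransitionTo (pathSet T) (obc L) x x :=
  fun n => ⟨x, hx.1, rfl, fun _ _ => rfl, n, le_rfl, fun _ _ => rfl⟩

theorem classes_finite [Finite S] (T : S → S → Prop) (L : S → D) (z : ℤ → D) :
    (transClassesOver (pathSet T) (obc L) z).Finite := by
  classical
  have : Fintype S := Fintype.ofFinite S
  by_contra hinf
  obtain ⟨t, ht, hcard⟩ := Set.Infinite.exists_subset_card_eq hinf (Fintype.card S + 1)
  have hrep : ∀ c : t, ∃ x, FibP T L z x ∧ c.1 = transClass (pathSet T) (obc L) x := by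
    intro c
    obtain ⟨x, hx, hxz, hc⟩ := ht c.2
    exact ⟨x, ⟨hx, hxz⟩, hc⟩
  choose x hx hxc using hrep
  have hpig : ∀ n : ℕ, ∃ q : t × t, q.1 ≠ q.2 ∧ x q.1 (n : ℤ) = x q.2 (n : ℤ) := by
    intro n
    obtain ⟨i, j, hij, he⟩ := Fintype.exists_ne_map_eq_of_card_lt (fun c : t => x c (n : ℤ))
      (by rw [Fintype.card_coe, hcard]; omega)
    exact ⟨(i, j), hij, he⟩
  choose q hq1 hq2 using hpig
  obtain ⟨⟨i, j⟩, hy⟩ := Finite.exists_infinite_fiber q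
  have hfr : ∀ n : ℤ, ∃ m, n ≤ m ∧ x i m = x j m := by
    intro n
    have hy' : (q ⁻¹' {(i, j)}).Infinite := Set.infinite_coe_iff.mp hy
    obtain ⟨m, hm, hlt⟩ := hy'.exists_gt n.toNat
    refine ⟨m, by omega, ?_⟩
    have := hq2 m
    rw [show q m = (i, j) from hm] at this
    exact this
  have hne : i ≠ j := by
    obtain ⟨m, hm⟩ := (Set.infinite_coe_iff.mp hy).nonempty
    have := hq1 m
    rwa [show q m = (i, j) from hm] at this
  apply hne
  apply Subtype.ext
  rw [hxc i, hxc j]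
  apply transClass_eq (hx i) (hx j)
  constructor
  · apply trans_of_freq (hx i) (hx j)
    intro n
    obtain ⟨m, hm, he⟩ := hfr n
    exact ⟨m, hm, 0, by simpa [wordAt, PR] using he⟩
  · apply trans_of_freq (hx j) (hx i)
    intro n
    obtain ⟨m, hm, he⟩ := hfr n
    exact ⟨m, hm, 0, by simpa [wordAt, PR] using he.symm⟩

/-- From a point with `c` classes over it we get a word routing through `c` states. -/
theorem exists_thr [Finite S] (T : S → S → Prop) (L : S → D) (z : ℤ → D) :
    ∃ (i : ℤ) (n : ℕ), 0 < n ∧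
      ThrW T L (wordAt z i n) (Nat.card (transClassesOver (pathSet T) (obc L) z)) := by
  classical
  have : Fintype S := Fintype.ofFinite S
  have : Finite (transClassesOver (pathSet T) (obc L) z) := classes_finite T L z
  let e := Finite.equivFin (transClassesOver (pathSet T) (obc L) z)
  set c := Nat.card (transClassesOver (pathSet T) (obc L) z) with hc
  have hm : ∀ i : Fin c, ∃ x, FibP T L z x ∧ (e.symm i).1 = transClass (pathSet T) (obc L) x := by
    intro i
    obtain ⟨x, hx, hxz, hcc⟩ := (e.symm i).2
    exact ⟨x, ⟨hx, hxz⟩, hcc⟩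
  choose m hmf hmc using hm
  have hall : ∀ x, FibP T L z x → ∃ i, TransEquiv (pathSet T) (obc L) x (m i) := by
    intro x hx
    refine ⟨e ⟨_, x, hx.1, hx.2, rfl⟩, ?_⟩
    have h1 := hmc (e ⟨_, x, hx.1, hx.2, rfl⟩)
    rw [Equiv.symm_apply_apply] at h1
    have h2 : m (e ⟨_, x, hx.1, hx.2, rfl⟩) ∈
        transClass (pathSet T) (obc L) (m (e ⟨_, x, hx.1, hx.2, rfl⟩)) :=
      ⟨(hmf _).1, rfl, trans_refl (hmf _), trans_refl (hmf _)⟩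
    rw [← h1] at h2
    exact h2.2.2
  have hN : ∀ (a : S) (i : Fin c), ∃ k : ℕ, (∃ x, FibP T L z x ∧ x 0 = a ∧
      TransitionTo (pathSet T) (obc L) x (m i)) → PR T L (wordAt z 0 k) a (m i (0 + k)) := by
    intro a i
    by_cases h : ∃ x, FibP T L z x ∧ x 0 = a ∧ TransitionTo (pathSet T) (obc L) x (m i)
    · obtain ⟨x, hx, rfl, ht⟩ := h
      obtain ⟨k, hk⟩ := (trans_iff hx (hmf i)).1 ht 0
      exact ⟨k, fun _ => hk⟩
    · exact ⟨0, fun h' => absurd h' h⟩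
  choose kk hkk using hN
  let N : ℕ := Finset.univ.sup fun q : S × Fin c => kk q.1 q.2
  have hNle : ∀ a i, kk a i ≤ N := fun a i =>
    Finset.le_sup (f := fun q : S × Fin c => kk q.1 q.2) (Finset.mem_univ (a, i))
  by_contra hcon
  push Not at hcon
  let _ : TopologicalSpace S := ⊥
  have _ : DiscreteTopology S := ⟨rfl⟩
  let bad : ℕ → Set (ℤ → S) := fun K => {p |
    (∀ j : ℤ, -(K : ℤ) ≤ j → j < N + K + 1 → T (p j) (p (j + 1)) ∧ L (p j) = z j) ∧
    ¬ ∃ i, PR T L (wordAt z (-(K : ℤ)) (K + N)) (p (-(K : ℤ))) (m i N) ∧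
      PR T L (wordAt z N (K + 1)) (m i N) (p (N + K + 1))}
  have hne : ∀ K, (bad K).Nonempty := by
    intro K
    have h := hcon (-(K : ℤ)) ((K + N) + (K + 1)) (by omega)
    simp only [ThrW, not_exists, not_and] at h
    have e1 : wordAt z (-(K : ℤ)) ((K + N) + (K + 1)) =
        wordAt z (-(K : ℤ)) (K + N) ++ wordAt z N (K + 1) := by
      rw [wordAt_add]; congr 2; push_cast; ring
    have h := h _ _ (fun i => m i N) e1
    push Not at h
    obtain ⟨s, t, hst, h⟩ := h
    obtain ⟨p, hp1, hp2, hp3⟩ := path_of_PR hst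
    have e2 : -(K : ℤ) + ((K + N + (K + 1) : ℕ) : ℤ) = N + K + 1 := by push_cast; ring
    rw [e2] at hp2 hp3
    refine ⟨p, hp3, ?_⟩
    rintro ⟨i, h1, h2⟩
    rw [hp1] at h1
    rw [hp2] at h2
    exact h i h1 h2
  have hmono : ∀ K, bad (K + 1) ⊆ bad K := by
    rintro K p ⟨h1, h2⟩
    refine ⟨fun j hj1 hj2 => h1 j (by push_cast; omega) (by push_cast; omega), ?_⟩
    rintro ⟨i, g1, g2⟩
    refine h2 ⟨i, ?_, ?_⟩
    · have a1 : PR T L (wordAt z (-((K + 1 : ℕ) : ℤ)) 1) (p (-((K + 1 : ℕ) : ℤ)))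
          (p (-((K + 1 : ℕ) : ℤ) + (1 : ℕ))) :=
        PR_of_path fun j hj1 hj2 => h1 j hj1 (by push_cast at hj2 ⊢; omega)
      rw [show -((K + 1 : ℕ) : ℤ) + ((1 : ℕ) : ℤ) = -(K : ℤ) by push_cast; ring] at a1
      have := PR_app a1 g1
      rw [show K + 1 + N = 1 + (K + N) by ring, wordAt_add]
      rwa [show -((K + 1 : ℕ) : ℤ) + ((1 : ℕ) : ℤ) = -(K : ℤ) by push_cast; ring]
    · have a1 : PR T L (wordAt z (N + K + 1) 1) (p (N + K + 1)) (p (N + K + 1 + (1 : ℕ))) :=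
        PR_of_path fun j hj1 hj2 => h1 j (by push_cast; omega) (by push_cast at hj2 ⊢; omega)
      have := PR_app g2 a1
      rw [wordAt_add z N (K + 1) 1]
      rw [show (N : ℤ) + ((K + 1 : ℕ) : ℤ) = N + K + 1 by push_cast; ring]
      exact this
  have hclosed : ∀ K, IsClosed (bad K) := by
    intro K
    have hpair : ∀ (i j : ℤ) (Q : S → S → Prop), IsClosed {p : ℤ → S | Q (p i) (p j)} := by
      intro i j Q
      have hc : Continuous fun p : ℤ → S => (p i, p j) := by fun_prop
      exact (isClosed_discrete {q : S × S | Q q.1 q.2}).preimage hc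
    have e : bad K = (⋂ j : ℤ, {p : ℤ → S | (fun s t => -(K : ℤ) ≤ j → j < N + K + 1 →
        T s t ∧ L s = z j) (p j) (p (j + 1))}) ∩
        {p : ℤ → S | (fun s t => ¬ ∃ i, PR T L (wordAt z (-(K : ℤ)) (K + N)) s (m i N) ∧
      PR T L (wordAt z N (K + 1)) (m i N) t) (p (-(K : ℤ))) (p (N + K + 1))} := by
      ext p
      simp only [bad, Set.mem_ofPred_eq, Set.mem_inter_iff, Set.mem_iInter]
    rw [e]
    exact (isClosed_iInter fun j => hpair j (j + 1) (fun s t => -(K : ℤ) ≤ j → j < N + K + 1 →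
        T s t ∧ L s = z j)).inter (hpair (-(K : ℤ)) (N + K + 1)
        (fun s t => ¬ ∃ i, PR T L (wordAt z (-(K : ℤ)) (K + N)) s (m i N) ∧
          PR T L (wordAt z N (K + 1)) (m i N) t))
  obtain ⟨x, hx⟩ := IsCompact.nonempty_iInter_of_sequence_nonempty_isCompact_isClosed bad hmono hne
    (hclosed 0).isCompact hclosed
  rw [Set.mem_iInter] at hx
  have hxf : FibP T L z x := by
    have : ∀ j : ℤ, T (x j) (x (j + 1)) ∧ L (x j) = z j := fun j =>
      (hx j.natAbs).1 j (by omega) (by omega)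
    exact ⟨fun j => (this j).1, funext fun j => (this j).2⟩
  obtain ⟨i, hi1, hi2⟩ := hall x hxf
  have f1 := reach_mono (hmf i) (hNle (x 0) i) (hkk (x 0) i ⟨x, hxf, rfl, hi1⟩)
  rw [zero_add] at f1
  obtain ⟨k, hk⟩ := (trans_iff (hmf i) hxf).1 hi2 N
  refine (hx k).2 ⟨i, ?_, ?_⟩
  · rw [wordAt_add]
    have := hxf.pr (-(k : ℤ)) k
    rw [neg_add_cancel] at this ⊢
    exact PR_app this f1
  · have := reach_mono hxf (Nat.le_succ k) hk
    rwa [show (N : ℤ) + (k.succ : ℤ) = N + k + 1 by push_cast; ring] at this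

end Points

section Periodic

variable {S D C : Type*}

/-- The periodic point over an idempotent word. -/
theorem periodic_classes [Finite S] {T : S → S → Prop} {L : S → D} {w : List D} (hw : w ≠ [])
    (hid : PR T L (w ++ w) = PR T L w) (hl : LiveW T L w) {ι : Type*} [Finite ι]
    (κ : {a // PR T L w a a} → ι) (hκ : ∀ a c, κ a = κ c → PR T L w a.1 c.1) :
    ∃ z, (∃ x, FibP T L z x) ∧
      Nat.card (transClassesOver (pathSet T) (obc L) z) ≤ Nat.card ι := by
  classical
  have hidc : Relation.Comp (PR T L w) (PR T L w) = PR T L w := by rw [← PR_append]; exact hid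
  have hp0 : 0 < w.length := List.length_pos_iff.mpr hw
  set p : ℕ := w.length with hp
  have hpz : (0 : ℤ) < (p : ℤ) := by exact_mod_cast hp0
  have hlt : ∀ i : ℤ, (i % (p : ℤ)).toNat < w.length := by
    intro i
    have h1 := Int.emod_nonneg i hpz.ne'
    have h2 := Int.emod_lt_of_pos i hpz
    omega
  let z : ℤ → D := fun i => w[(i % (p : ℤ)).toNat]'(hlt i)
  have hzmod : ∀ i, z (i % (p : ℤ)) = z i := by
    intro i
    simp only [z, Int.emod_emod_of_dvd i (dvd_refl _)]
  have hword : ∀ j : ℤ, wordAt z (j * p) p = w := by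
    intro j
    apply List.ext_getElem
    · rw [wordAt_length]
    · intro k h1 h2
      rw [wordAt_getElem]
      have : ((j * (p : ℤ) + k) % (p : ℤ)).toNat = k := by
        rw [Int.mul_add_emod_self_right, Int.emod_eq_of_lt (by omega) (by omega)]
        simp
      simp only [z, this]
  have hwp : ∀ (m : ℕ) (j : ℤ), wordAt z (j * p) (m * p) = wp w m := by
    intro m
    induction m with
    | zero => intro j; simp [wordAt, wp]
    | succ m ih =>
      intro j
      rw [show (m + 1) * p = p + m * p by ring, wordAt_add, hword,
        show j * (p : ℤ) + p = (j + 1) * p by ring, ih]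
      rfl
  have hE : ∀ m, PR T L (wp w (m + 1)) = PR T L w := by
    intro m
    induction m with
    | zero => simp [wp]
    | succ m ih => rw [wp, PR_append, ih, hidc]
  refine ⟨z, ?_, ?_⟩
  · obtain ⟨s, t, hst⟩ := hl
    obtain ⟨a, -, haa, -⟩ := exists_recurrent hidc hst
    have h0 := hword 0
    rw [zero_mul] at h0
    rw [← h0] at haa
    obtain ⟨q, hq1, hq2, hq3⟩ := path_of_PR haa
    rw [zero_add] at hq2 hq3
    refine ⟨fun i => q (i % p), fun i => ?_, funext fun i => ?_⟩
    · have h1 := Int.emod_nonneg i hpz.ne'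
      have h2 := Int.emod_lt_of_pos i hpz
      have h3 := (hq3 (i % p) h1 h2).1
      beta_reduce
      by_cases hc : i % (p : ℤ) + 1 = p
      · have : (i + 1) % (p : ℤ) = 0 := by
          rw [Int.add_emod, ← Int.emod_emod_of_dvd i (dvd_refl (p : ℤ))]
          rw [← Int.add_emod, hc, Int.emod_self]
        rw [this, hq1]
        rwa [hc, hq2] at h3
      · have : (i + 1) % (p : ℤ) = i % p + 1 := by
          rw [← Int.emod_add_emod]
          exact Int.emod_eq_of_lt (by omega) (by omega)
        rw [this]; exact h3
    · have h1 := Int.emod_nonneg i hpz.ne'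
      have h2 := Int.emod_lt_of_pos i hpz
      rw [← hzmod i]
      exact (hq3 (i % p) h1 h2).2
  · have hrec : ∀ x, FibP T L z x → ∃ a : {a // PR T L w a a},
        ∀ n : ℤ, ∃ j : ℤ, n ≤ j ∧ x (j * p) = a.1 := by
      intro x hx
      obtain ⟨a, ha⟩ := Finite.exists_infinite_fiber (fun j : ℕ => x ((j : ℤ) * p))
      have ha' := Set.infinite_coe_iff.mp ha
      have hfr : ∀ n : ℤ, ∃ j : ℤ, n ≤ j ∧ x (j * p) = a := by
        intro n
        obtain ⟨m, hm, hlt⟩ := ha'.exists_gt n.toNat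
        exact ⟨m, by omega, hm⟩
      obtain ⟨j, -, hj⟩ := hfr 0
      obtain ⟨j', hjj, hj'⟩ := hfr (j + 1)
      obtain ⟨d, rfl⟩ := Int.le.dest hjj
      have := hx.pr (j * p) ((d + 1) * p)
      rw [hwp, hE, hj, show j * (p : ℤ) + (((d + 1) * p : ℕ) : ℤ) = (j + 1 + d) * p by
        push_cast; ring, hj'] at this
      exact ⟨⟨a, this⟩, hfr⟩
    have hcls : ∀ c : transClassesOver (pathSet T) (obc L) z, ∃ x, FibP T L z x ∧
        c.1 = transClass (pathSet T) (obc L) x := by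
      rintro ⟨c, x, hx, hxz, hc⟩
      exact ⟨x, ⟨hx, hxz⟩, hc⟩
    choose x hx hxc using hcls
    choose a ha using fun c => hrec (x c) (hx c)
    refine Nat.card_le_card_of_injective (fun c => κ (a c)) ?_
    have key : ∀ c c', κ (a c) = κ (a c') → TransitionTo (pathSet T) (obc L) (x c) (x c') := by
      intro c c' h
      apply trans_of_freq (hx c) (hx c')
      intro n
      obtain ⟨j, hj, hja⟩ := ha c (max n 0)
      obtain ⟨j', hj', hja'⟩ := ha c' (j + 1)
      obtain ⟨d, rfl⟩ := Int.le.dest hj'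
      refine ⟨j * p, ?_, (d + 1) * p, ?_⟩
      · have : (0 : ℤ) ≤ j := le_trans (le_max_right _ _) hj
        have : n ≤ j := le_trans (le_max_left _ _) hj
        nlinarith
      · rw [hwp, hE, hja, show j * (p : ℤ) + (((d + 1) * p : ℕ) : ℤ) = (j + 1 + d) * p by
          push_cast; ring, hja']
        exact hκ _ _ h
    intro c c' h
    apply Subtype.ext
    rw [hxc c, hxc c']
    exact transClass_eq (hx c) (hx c') ⟨key _ _ h, key _ _ h.symm⟩

theorem wordAt_ne {α : Type*} (f : ℤ → α) (i : ℤ) (n : ℕ) (hn : 0 < n) :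
    wordAt f i n ≠ [] := by
  intro h
  have := wordAt_length f i n
  rw [h] at this
  simp at this
  omega

theorem ne_nil_of_inf {α : Type*} {u v : List α} (hu : u ≠ []) (hv : u <:+: v) : v ≠ [] := by
  rintro rfl
  exact hu (List.infix_nil.mp hv)

/-- The theorem for one-step shifts of finite type and one-block codes. -/
theorem onestep_main {S2 : Type*} [Finite S] [Finite S2]
    {T : S → S → Prop} {T2 : S2 → S2 → Prop} {lam : S → S2} {ell : S2 → C}
    {Z : Set (ℤ → C)}
    (hT : ∀ s t, T s t → T2 (lam s) (lam t))
    {Ess : S → Prop} (hess : ∀ s t, T s t → Ess s ∧ Ess t)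
    (hconn : ∀ s t, Ess s → Ess t → ∃ w, PR T (fun x => ell (lam x)) w s t)
    (hT2 : ∀ b p q, b ≠ [] → PR T2 (fun x => x) b p q → ∃ y ∈ pathSet T2, ∃ i,
      wordAt y i b.length = b)
    (hon1 : ∀ y ∈ pathSet T2, ∃ x ∈ pathSet T, obc lam x = y)
    (hto2 : ∀ y ∈ pathSet T2, obc ell y ∈ Z)
    (hon2 : ∀ z ∈ Z, ∃ y ∈ pathSet T2, obc ell y = z) :
    classDegree (pathSet T) Z (obc fun x => ell (lam x)) ≤
      classDegree (pathSet T) (pathSet T2) (obc lam) * classDegree (pathSet T2) Z (obc ell) := by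
  by_cases hZ : Z.Nonempty
  swap
  · rw [Set.not_nonempty_iff_eq_empty] at hZ
    subst hZ
    simp [classDegree]
  obtain ⟨z0, hz0⟩ := hZ
  obtain ⟨y0, hy0, -⟩ := hon2 z0 hz0
  have m1 : classDegree (pathSet T) (pathSet T2) (obc lam) ∈
      {d | ∃ y ∈ pathSet T2, Nat.card (transClassesOver (pathSet T) (obc lam) y) = d} :=
    Nat.sInf_mem ⟨_, y0, hy0, rfl⟩
  have m2 : classDegree (pathSet T2) Z (obc ell) ∈
      {d | ∃ z ∈ Z, Nat.card (transClassesOver (pathSet T2) (obc ell) z) = d} :=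
    Nat.sInf_mem ⟨_, z0, hz0, rfl⟩
  obtain ⟨y, hy, hyc⟩ := m1
  obtain ⟨z, hz, hzc⟩ := m2
  obtain ⟨i1, k1, hk1, ht1⟩ := exists_thr T lam y
  obtain ⟨i2, k2, hk2, ht2⟩ := exists_thr T2 ell z
  rw [hyc] at ht1
  rw [hzc] at ht2
  have hlive1 : ∀ y ∈ pathSet T2, ∀ i n, LiveW T lam (wordAt y i n) := by
    intro y hy i n
    obtain ⟨x, hx, hxy⟩ := hon1 y hy
    exact ⟨_, _, FibP.pr ⟨hx, hxy⟩ i n⟩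
  have hlift : ∀ b p q, b ≠ [] → PR T2 (fun x => x) b p q → LiveW T lam b := by
    intro b p q hb h
    obtain ⟨y', hy', i, hi⟩ := hT2 b p q hb h
    rw [← hi]
    exact hlive1 y' hy' _ _
  have hlive2 : LiveW T (fun x => ell (lam x)) (wordAt z i2 k2) := by
    obtain ⟨y', hy', hyz⟩ := hon2 z hz
    obtain ⟨x, hx, hxy⟩ := hon1 y' hy'
    exact ⟨_, _, FibP.pr ⟨hx, by rw [← hyz, ← hxy]; rfl⟩ i2 k2⟩
  obtain ⟨w1, hw1i, hw1l, hw1s⟩ := exists_star T lam _ (hlive1 y hy i1 k1) (by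
    intro w a b hwi hab
    have e := PR_ess hess (ne_nil_of_inf (wordAt_ne y i1 k1 hk1) hwi) hab
    obtain ⟨v, hv⟩ := hconn b a e.2 e.1
    obtain ⟨b', -, hb'⟩ := PR_lift hv
    exact ⟨b', hb'⟩)
  obtain ⟨w, hwi, hwl, hws⟩ := exists_star T (fun x => ell (lam x)) _ hlive2 (by
    intro w a b hwi hab
    have e := PR_ess hess (ne_nil_of_inf (wordAt_ne z i2 k2 hk2) hwi) hab
    exact hconn b a e.2 e.1)
  have hw : w ≠ [] := ne_nil_of_inf (wordAt_ne z i2 k2 hk2) hwi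
  obtain ⟨κ, hκ⟩ := comb_main hT hess hconn hlift hw hws
    (ne_nil_of_inf (wordAt_ne y i1 k1 hk1) hw1i) hw1l hw1s (wordAt_ne z i2 k2 hk2) hlive2 (ht1.ext hw1i) ht2
  obtain ⟨z', ⟨x, hx⟩, hcard⟩ := periodic_classes hw hws.1 hwl κ hκ
  rw [Nat.card_prod, Nat.card_fin, Nat.card_fin] at hcard
  refine le_trans (Nat.sInf_le ⟨z', ?_, rfl⟩) hcard
  rw [← hx.2]
  exact hto2 (obc lam x) fun i => hT _ _ (hx.1 i)

end Periodic

section Recode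

/-- The sliding window recoding. -/
def win {A : Type*} (N : ℕ) (x : ℤ → A) : ℤ → Fin (2 * N + 1) → A :=
  fun i j => x (i - (N : ℤ) + (j.1 : ℤ))

/-- Edges of the window graph of `X`. -/
def Edge {A : Type*} (X : Set (ℤ → A)) (N : ℕ) (s t : Fin (2 * N + 1) → A) : Prop :=
  ∃ x ∈ X, ∃ i : ℤ, win N x i = s ∧ win N x (i + 1) = t

theorem win_center {A : Type*} (N : ℕ) (x : ℤ → A) (i : ℤ) :
    win N x i ⟨N, by omega⟩ = x i := by
  simp [win]

theorem win_injective {A : Type*} (N : ℕ) : Function.Injective (win (A := A) N) := by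
  intro x x' h
  funext i
  rw [← win_center N x, ← win_center N x', h]

theorem pathSet_edge {A : Type*} {X : Set (ℤ → A)} {N k : ℕ} {P : (Fin k → A) → Prop}
    (hX : X = {x | ∀ i : ℤ, P fun j => x (i + (j.1 : ℤ))}) (hk : k ≤ N) :
    pathSet (Edge X N) = win N '' X := by
  ext p
  constructor
  · intro hp
    have hstep : ∀ (j : ℕ) (i : ℤ) (hj : j < 2 * N + 1),
        p i ⟨j, hj⟩ = p (i + j) ⟨0, by omega⟩ := by
      intro j
      induction j with
      | zero => intro i hj; simp
      | succ j ih =>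
        intro i hj
        have h1 : p i ⟨j + 1, hj⟩ = p (i + 1) ⟨j, by omega⟩ := by
          obtain ⟨x, -, i', h1, h2⟩ := hp i
          rw [← h1, ← h2]
          simp only [win]
          congr 1; push_cast; ring
        rw [h1, ih, show i + 1 + (j : ℤ) = i + ((j + 1 : ℕ) : ℤ) by push_cast; ring]
    refine ⟨fun m => p (m + N) ⟨0, by omega⟩, ?_, ?_⟩
    · rw [hX]
      intro i
      obtain ⟨x, hx, i', h1, -⟩ := hp (i + N)
      rw [hX] at hx
      have := hx (i' - N)
      convert this using 2 with j
      have hj := j.2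
      have e := hstep j.1 (i + N) (by omega)
      rw [← h1] at e
      beta_reduce
      rw [show i + (j.1 : ℤ) + N = i + N + j.1 by ring, ← e]
      rfl
    · funext i j
      simp only [win]
      rw [hstep j.1 i j.2, show i - (N : ℤ) + (j.1 : ℤ) + N = i + j.1 by ring]
  · rintro ⟨x, hx, rfl⟩ i
    exact ⟨x, hx, i, rfl, rfl⟩

theorem win_trans {A B B' : Type*} {X : Set (ℤ → A)} {N : ℕ} {π : (ℤ → A) → ℤ → B}
    {π' : (ℤ → Fin (2 * N + 1) → A) → ℤ → B'} {θ : (ℤ → B) → ℤ → B'}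
    (hθ : Function.Injective θ) (hc : ∀ x, π' (win N x) = θ (π x)) (x x' : ℤ → A) :
    TransitionTo (win N '' X) π' (win N x) (win N x') ↔ TransitionTo X π x x' := by
  constructor
  · intro h n
    obtain ⟨_, ⟨z, hz, rfl⟩, h1, h2, i, hi, h3⟩ := h n
    refine ⟨z, hz, hθ (by rw [← hc, ← hc, h1]), fun m hm => ?_, i, hi, fun m hm => ?_⟩
    · rw [← win_center N z, h2 m hm, win_center]
    · rw [← win_center N z, h3 m hm, win_center]
  · intro h n
    obtain ⟨z, hz, h1, h2, i, hi, h3⟩ := h (n + N)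
    refine ⟨win N z, ⟨z, hz, rfl⟩, by rw [hc, hc, h1], fun m hm => ?_, i + N, by omega,
      fun m hm => ?_⟩
    · funext j
      have := j.2
      exact h2 _ (by omega)
    · funext j
      exact h3 _ (by omega)

theorem win_transClass {A B B' : Type*} {X : Set (ℤ → A)} {N : ℕ} {π : (ℤ → A) → ℤ → B}
    {π' : (ℤ → Fin (2 * N + 1) → A) → ℤ → B'} {θ : (ℤ → B) → ℤ → B'}
    (hθ : Function.Injective θ) (hc : ∀ x, π' (win N x) = θ (π x)) (x : ℤ → A) :
    transClass (win N '' X) π' (win N x) = win N '' transClass X π x := by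
  ext p
  constructor
  · rintro ⟨⟨x', hx', rfl⟩, h1, h2, h3⟩
    exact ⟨x', ⟨hx', hθ (by rw [← hc, ← hc, h1]), (win_trans hθ hc x x').1 h2,
      (win_trans hθ hc x' x).1 h3⟩, rfl⟩
  · rintro ⟨x', ⟨hx', h1, h2, h3⟩, rfl⟩
    exact ⟨⟨x', hx', rfl⟩, by rw [hc, hc, h1], (win_trans hθ hc x x').2 h2,
      (win_trans hθ hc x' x).2 h3⟩

theorem win_classes {A B B' : Type*} {X : Set (ℤ → A)} {N : ℕ} {π : (ℤ → A) → ℤ → B}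
    {π' : (ℤ → Fin (2 * N + 1) → A) → ℤ → B'} {θ : (ℤ → B) → ℤ → B'}
    (hθ : Function.Injective θ) (hc : ∀ x, π' (win N x) = θ (π x)) (y : ℤ → B) :
    transClassesOver (win N '' X) π' (θ y) =
      (fun c => win N '' c) '' transClassesOver X π y := by
  ext c
  constructor
  · rintro ⟨_, ⟨x, hx, rfl⟩, h1, rfl⟩
    exact ⟨_, ⟨x, hx, hθ (by rw [← hc, h1]), rfl⟩, (win_transClass hθ hc x).symm⟩
  · rintro ⟨_, ⟨x, hx, h1, rfl⟩, rfl⟩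
    exact ⟨_, ⟨x, hx, rfl⟩, by rw [hc, h1], (win_transClass hθ hc x).symm⟩

theorem win_classDegree {A B B' : Type*} {X : Set (ℤ → A)} {N : ℕ} {π : (ℤ → A) → ℤ → B}
    {π' : (ℤ → Fin (2 * N + 1) → A) → ℤ → B'} {θ : (ℤ → B) → ℤ → B'}
    (hθ : Function.Injective θ) (hc : ∀ x, π' (win N x) = θ (π x)) (Y : Set (ℤ → B)) :
    classDegree (win N '' X) (θ '' Y) π' = classDegree X Y π := by
  have h : ∀ y, Nat.card (transClassesOver (win N '' X) π' (θ y)) =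
      Nat.card (transClassesOver X π y) := by
    intro y
    rw [win_classes hθ hc]
    exact Nat.card_image_of_injective (Set.image_injective.2 (win_injective N)) _
  unfold classDegree
  congr 1
  ext d
  constructor
  · rintro ⟨_, ⟨y, hy, rfl⟩, rfl⟩
    exact ⟨y, hy, (h y).symm⟩
  · rintro ⟨y, hy, rfl⟩
    exact ⟨θ y, ⟨y, hy, rfl⟩, h y⟩

theorem edge_conn {A D : Type*} [TopologicalSpace A] {X : Set (ℤ → A)}
    (hX : IrreducibleSubshift X) (N : ℕ) (L : (Fin (2 * N + 1) → A) → D)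
    (s t : Fin (2 * N + 1) → A) (hs : ∃ x ∈ X, ∃ i, win N x i = s)
    (ht : ∃ x ∈ X, ∃ i, win N x i = t) : ∃ w, PR (Edge X N) L w s t := by
  obtain ⟨x, hx, i, rfl⟩ := hs
  obtain ⟨x', hx', i', rfl⟩ := ht
  obtain ⟨y, hy, a, b, hab, h1, h2⟩ := hX _ _ (win N x i) (win N x' i')
    ⟨x, hx, i - N, fun j => rfl⟩ ⟨x', hx', i' - N, fun j => rfl⟩
  have hf : FibP (Edge X N) L (obc L (win N y)) (win N y) :=
    ⟨fun j => ⟨y, hy, j, rfl, rfl⟩, rfl⟩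
  have := hf.pr (a + N) (b - a).toNat
  rw [show a + (N : ℤ) + ((b - a).toNat : ℤ) = b + N by omega] at this
  have e1 : win N y (a + N) = win N x i := by
    funext j
    rw [← h1 j]
    simp [win]
  have e2 : win N y (b + N) = win N x' i' := by
    funext j
    rw [← h2 j]
    simp [win]
  rw [e1, e2] at this
  exact ⟨_, this⟩

theorem edge_ext {A : Type*} {Y : Set (ℤ → A)} {N : ℕ} (b : List (Fin (2 * N + 1) → A))
    (p q : Fin (2 * N + 1) → A) (hb : b ≠ []) (h : PR (Edge Y N) (fun x => x) b p q) :
    ∃ y ∈ pathSet (Edge Y N), ∃ i, wordAt y i b.length = b := by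
  have hpos : 0 < b.length := List.length_pos_iff.2 hb
  have hw : ∀ z : ℤ → Fin (2 * N + 1) → A, (∀ k (hk : k < b.length), z k = b[k]) →
      wordAt z 0 b.length = b := by
    intro z hz
    apply List.ext_getElem (wordAt_length _ _ _)
    intro k hk hk'
    rw [wordAt_getElem, zero_add, hz k hk']
  set z : ℤ → Fin (2 * N + 1) → A := fun j => b.getD j.toNat p with hz
  have hzb : ∀ k (hk : k < b.length), z k = b[k] := by
    intro k hk
    simp [hz, hk]
  rw [← hw z hzb] at h
  obtain ⟨f, -, -, hf⟩ := path_of_PR h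
  set n : ℤ := (b.length : ℤ) with hn
  obtain ⟨y1, hy1, i1, e1, -⟩ := (hf 0 le_rfl (by omega)).1
  obtain ⟨y2, hy2, i2, -, e2⟩ := (hf (n - 1) (by omega) (by omega)).1
  rw [sub_add_cancel] at e2
  let y : ℤ → Fin (2 * N + 1) → A := fun m => if m < 0 then win N y1 (i1 + m) else
    if m < n then f m else win N y2 (i2 + 1 + (m - n))
  have c1 : ∀ m ≤ 0, y m = win N y1 (i1 + m) := by
    intro m hm
    by_cases h0 : m < 0
    · simp [y, h0]
    · have : m = 0 := by omega
      subst this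
      simp only [y, lt_irrefl, if_false, if_pos (show (0 : ℤ) < n by omega), add_zero, e1]
  have c2 : ∀ m, 0 ≤ m → m < n → y m = f m := by
    intro m h1 h2
    simp only [y, if_neg (not_lt.2 h1), if_pos h2]
  have c3 : ∀ m, n ≤ m → y m = win N y2 (i2 + 1 + (m - n)) := by
    intro m h1
    simp only [y, if_neg (show ¬ m < 0 by omega), if_neg (not_lt.2 h1)]
  refine ⟨y, ?_, 0, ?_⟩
  · intro m
    rcases lt_or_ge m 0 with h1 | h1
    · rw [c1 m h1.le, c1 (m + 1) (by omega)]
      exact ⟨y1, hy1, _, rfl, by rw [add_assoc]⟩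
    rcases lt_or_ge m n with h2 | h2
    · have := (hf m h1 (by omega)).1
      rw [c2 m h1 h2]
      rcases lt_or_ge (m + 1) n with h3 | h3
      · rw [c2 (m + 1) (by omega) h3]; exact this
      · have h4 : m + 1 = n := by omega
        rw [c3 (m + 1) h3, h4, sub_self, add_zero, e2, ← h4]; exact this
    · rw [c3 m h2, c3 (m + 1) (by omega)]
      exact ⟨y2, hy2, _, rfl, by congr 1; ring⟩
  · apply hw
    intro k hk
    rw [c2 k (by omega) (by omega), ← hzb k hk]
    exact (hf k (by omega) (by omega)).2

end Recode

theorem classDegree_comp_le {C : Type uc} [Fintype A] [TopologicalSpace A] [DiscreteTopology A]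
    [Fintype B] [TopologicalSpace B] [DiscreteTopology B]
    [Fintype C] [TopologicalSpace C] [DiscreteTopology C]
    (X : Set (ℤ → A)) (Y : Set (ℤ → B)) (Z : Set (ℤ → C))
    (π₁ : (ℤ → A) → ℤ → B) (π₂ : (ℤ → B) → ℤ → C)
    (h₁ : FactorTriple X Y π₁) (hXirr : IrreducibleSubshift X)
    (h₂ : FactorTriple Y Z π₂) (hYirr : IrreducibleSubshift Y) :
    classDegree X Z (fun x => π₂ (π₁ x)) ≤
      classDegree X Y π₁ * classDegree Y Z π₂ := by
  obtain ⟨⟨-, k, P, hX⟩, -, ⟨r1, Φ1, hΦ1⟩, hto1, hon1⟩ := h₁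
  obtain ⟨⟨-, k2, P2, hY⟩, -, ⟨r2, Φ2, hΦ2⟩, hto2, hon2⟩ := h₂
  set N2 : ℕ := r2 + k2 with hN2
  set N : ℕ := N2 + r1 + k with hN
  let lam : (Fin (2 * N + 1) → A) → Fin (2 * N2 + 1) → B := fun q j =>
    Φ1 fun j' => q ⟨k + j.1 + j'.1, by have := j.2; have := j'.2; omega⟩
  let ell : (Fin (2 * N2 + 1) → B) → C := fun q =>
    Φ2 fun j => q ⟨k2 + j.1, by have := j.2; omega⟩
  have hlam' : ∀ x i, lam (win N x i) = win N2 (π₁ x) i := by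
    intro x i
    funext j
    simp only [lam, win, hΦ1]
    congr 1
    funext j'
    congr 1
    rw [hN]; push_cast; ring
  have hell' : ∀ y i, ell (win N2 y i) = π₂ y i := by
    intro y i
    simp only [ell, win, hΦ2]
    congr 1
    funext j'
    congr 1
    rw [hN2]; push_cast; ring
  have hlam : ∀ x, obc lam (win N x) = win N2 (π₁ x) := fun x => funext fun i => hlam' x i
  have hell : ∀ y, obc ell (win N2 y) = π₂ y := fun y => funext fun i => hell' y i
  have eX : pathSet (Edge X N) = win N '' X := pathSet_edge hX (by omega)
  have eY : pathSet (Edge Y N2) = win N2 '' Y := pathSet_edge hY (by omega)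
  have main := onestep_main (T := Edge X N) (T2 := Edge Y N2) (lam := lam) (ell := ell) (Z := Z)
    (by
      rintro s t ⟨x, hx, i, rfl, rfl⟩
      exact ⟨π₁ x, hto1 x hx, i, (hlam' x i).symm, (hlam' x (i + 1)).symm⟩)
    (Ess := fun s => ∃ x ∈ X, ∃ i, win N x i = s)
    (by
      rintro s t ⟨x, hx, i, rfl, rfl⟩
      exact ⟨⟨x, hx, i, rfl⟩, ⟨x, hx, i + 1, rfl⟩⟩)
    (fun s t hs ht => edge_conn hXirr N _ s t hs ht)
    (fun b p q hb h => edge_ext b p q hb h)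
    (by
      rw [eX, eY]
      rintro _ ⟨y, hy, rfl⟩
      obtain ⟨x, hx, rfl⟩ := hon1 y hy
      exact ⟨_, ⟨x, hx, rfl⟩, hlam x⟩)
    (by
      rw [eY]
      rintro _ ⟨y, hy, rfl⟩
      rw [hell]
      exact hto2 y hy)
    (by
      rw [eY]
      intro z hz
      obtain ⟨y, hy, rfl⟩ := hon2 z hz
      exact ⟨_, ⟨y, hy, rfl⟩, hell y⟩)
  rw [eX, eY, win_classDegree (win_injective N2) hlam] at main
  have a1 := win_classDegree (X := Y) (θ := fun z => z) (fun _ _ h => h) hell Z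
  have a2 := win_classDegree (X := X) (N := N) (π := fun x => π₂ (π₁ x))
    (π' := obc fun x => ell (lam x)) (θ := fun z => z) (fun _ _ h => h) (by
      intro x
      funext i
      change ell (lam (win N x i)) = _
      rw [hlam', hell']) Z
  rw [Set.image_id'] at a1 a2
  rw [a1, a2] at main
  exact main
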